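/- Let Ω ⊂ ℝ² be open and bounded, let ε > 0, and let u : εℒ → S¹ be a spin field. Let Ω′ ⊆ Ω be such that the closed ball of radius √3·ε centered at every point of Ω′ is contained in Ω, and let E := ⋃ {T : T is an ε-triangle with χ(u, T) > 0}. Then ℋ¹(∂E ∩ Ω′) ≤ 5·F_ε(u, Ω), where ∂E denotes the topological boundary of E. -/

import Mathlib

open Real MeasureTheory
open scoped Pointwise

noncomputable section

/-- The plane `ℝ²` with the Euclidean structure. -/
abbrev E2 := EuclideanSpace ℝ (Fin 2)

/-- The lattice direction `ê₁ = (1,0)`. -/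
def e1 : E2 := (WithLp.equiv 2 (Fin 2 → ℝ)).symm ![1, 0]

/-- The lattice direction `ê₂ = (1/2, √3/2)`. -/
def e2 : E2 := (WithLp.equiv 2 (Fin 2 → ℝ)).symm ![1 / 2, Real.sqrt 3 / 2]

/-- The lattice direction `ê₃ = (-1/2, √3/2)`. -/
def e3 : E2 := (WithLp.equiv 2 (Fin 2 → ℝ)).symm ![-(1 / 2), Real.sqrt 3 / 2]

/-- The triangular lattice `ℒ = {z₁ê₁ + z₂ê₂ : z₁, z₂ ∈ ℤ}`. -/
def TriLat : Set E2 := {x | ∃ z₁ z₂ : ℤ, x = (z₁ : ℝ) • e1 + (z₂ : ℝ) • e2}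

/-- The sublattice `ℒ¹ = {z₁(ê₁+ê₂) + z₂(ê₂+ê₃) : z₁, z₂ ∈ ℤ}`. -/
def TriLat1 : Set E2 := {x | ∃ z₁ z₂ : ℤ, x = (z₁ : ℝ) • (e1 + e2) + (z₂ : ℝ) • (e2 + e3)}

/-- The sublattice `ℒ² = ℒ¹ + ê₁`. -/
def TriLat2 : Set E2 := {x | ∃ y ∈ TriLat1, x = y + e1}

/-- The sublattice `ℒ³ = ℒ¹ + ê₂`. -/
def TriLat3 : Set E2 := {x | ∃ y ∈ TriLat1, x = y + e2}

/-- A (unit) triangle of the triangular lattice, with vertices `i ∈ ℒ¹`, `j ∈ ℒ²`,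
`k ∈ ℒ³` at pairwise distance `1`. -/
structure Tri where
  i : E2
  j : E2
  k : E2
  hi : i ∈ TriLat1
  hj : j ∈ TriLat2
  hk : k ∈ TriLat3
  dij : ‖i - j‖ = 1
  djk : ‖j - k‖ = 1
  dki : ‖k - i‖ = 1

/-- The `ε`-triangle `conv{εi, εj, εk}` associated with a unit triangle. -/
def Tri.set (ε : ℝ) (T : Tri) : Set E2 := convexHull ℝ {ε • T.i, ε • T.j, ε • T.k}

/-- The scalar cross product `a × b = a₁b₂ - a₂b₁`. -/
def cross (a b : E2) : ℝ := a 0 * b 1 - a 1 * b 0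

/-- The chirality `χ(u, T)` of the spin field `u` on the `ε`-triangle `T`. -/
def chi (ε : ℝ) (u : E2 → E2) (T : Tri) : ℝ :=
  2 / (3 * Real.sqrt 3) *
    (cross (u (ε • T.i)) (u (ε • T.j)) + cross (u (ε • T.j)) (u (ε • T.k)) +
      cross (u (ε • T.k)) (u (ε • T.i)))

/-- The energy `F_ε(u, T) = ε|u(εi) + u(εj) + u(εk)|²` of one `ε`-triangle. -/
def triEnergy (ε : ℝ) (u : E2 → E2) (T : Tri) : ℝ :=
  ε * ‖u (ε • T.i) + u (ε • T.j) + u (ε • T.k)‖ ^ 2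

/-- The energy `F_ε(u, A)`, the sum of the energies of all `ε`-triangles contained in `A`. -/
def F (ε : ℝ) (u : E2 → E2) (A : Set E2) : ℝ :=
  ∑' T : {T : Tri // Tri.set ε T ⊆ A}, triEnergy ε u T

end

/-- The point of the plane with (real) lattice coordinates `a`, `b`. -/
noncomputable def latPt (a b : ℝ) : E2 := a • e1 + b • e2

lemma latPt_apply_zero (a b : ℝ) : latPt a b 0 = a + b / 2 := by
  simp [latPt, e1, e2]; ring

lemma latPt_apply_one (a b : ℝ) : latPt a b 1 = b * (√3 / 2) := by
  simp [latPt, e1, e2]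

lemma latPt_sub (a b c d : ℝ) : latPt a b - latPt c d = latPt (a - c) (b - d) := by
  simp only [latPt]; module

lemma norm_latPt_sq (a b : ℝ) : ‖latPt a b‖ ^ 2 = a ^ 2 + a * b + b ^ 2 := by
  have h : √3 ^ 2 = 3 := Real.sq_sqrt (by norm_num)
  rw [EuclideanSpace.norm_sq_eq, Fin.sum_univ_two, latPt_apply_zero, latPt_apply_one]
  simp only [Real.norm_eq_abs, sq_abs]
  linear_combination b ^ 2 / 4 * h

lemma exists_eq_smul_latPt {ε : ℝ} (hε : 0 < ε) (x : E2) : ∃ a b : ℝ, x = ε • latPt a b := by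
  have h3 : √3 ≠ 0 := by positivity
  refine ⟨(x 0 - x 1 / √3) / ε, 2 * x 1 / (√3 * ε), ?_⟩
  ext i
  fin_cases i
  · simp only [Fin.zero_eta, PiLp.smul_apply, smul_eq_mul, latPt_apply_zero]
    field_simp
    ring
  · simp only [Fin.mk_one, PiLp.smul_apply, smul_eq_mul, latPt_apply_one]
    field_simp

lemma latPt_mem_triLat (m n : ℤ) : latPt m n ∈ TriLat := ⟨m, n, rfl⟩

lemma latPt_eq_generators (z₁ z₂ : ℝ) :
    latPt (z₁ - z₂) (z₁ + 2 * z₂) = z₁ • (e1 + e2) + z₂ • (e2 + e3) := by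
  have h : e3 = e2 - e1 := by
    ext i
    fin_cases i <;> simp [e1, e2, e3]
    norm_num
  rw [h, latPt]
  module

lemma mem_triLat1_iff {x : E2} :
    x ∈ TriLat1 ↔ ∃ z₁ z₂ : ℤ, x = latPt (z₁ - z₂ : ℤ) (z₁ + 2 * z₂ : ℤ) := by
  simp only [TriLat1, Set.mem_ofPred_eq]
  push_cast
  simp only [latPt_eq_generators]

lemma mem_triLat2_iff {x : E2} :
    x ∈ TriLat2 ↔ ∃ z₁ z₂ : ℤ, x = latPt (z₁ - z₂ + 1 : ℤ) (z₁ + 2 * z₂ : ℤ) := by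
  have h : ∀ a b : ℝ, latPt a b + e1 = latPt (a + 1) b := fun a b => by
    simp only [latPt]; module
  constructor
  · rintro ⟨y, hy, rfl⟩
    obtain ⟨z₁, z₂, rfl⟩ := mem_triLat1_iff.1 hy
    exact ⟨z₁, z₂, by rw [h]; push_cast; rfl⟩
  · rintro ⟨z₁, z₂, rfl⟩
    exact ⟨_, mem_triLat1_iff.2 ⟨z₁, z₂, rfl⟩, by rw [h]; push_cast; rfl⟩

lemma mem_triLat3_iff {x : E2} :
    x ∈ TriLat3 ↔ ∃ z₁ z₂ : ℤ, x = latPt (z₁ - z₂ : ℤ) (z₁ + 2 * z₂ + 1 : ℤ) := by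
  have h : ∀ a b : ℝ, latPt a b + e2 = latPt a (b + 1) := fun a b => by
    simp only [latPt]; module
  constructor
  · rintro ⟨y, hy, rfl⟩
    obtain ⟨z₁, z₂, rfl⟩ := mem_triLat1_iff.1 hy
    exact ⟨z₁, z₂, by rw [h]; push_cast; rfl⟩
  · rintro ⟨z₁, z₂, rfl⟩
    exact ⟨_, mem_triLat1_iff.2 ⟨z₁, z₂, rfl⟩, by rw [h]; push_cast; rfl⟩

lemma int_norm_eq_one {a b c d : ℤ} (h : ‖latPt a b - latPt c d‖ = 1) :
    (a - c) ^ 2 + (a - c) * (b - d) + (b - d) ^ 2 = 1 := by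
  have := norm_latPt_sq (a - c) (b - d)
  rw [← latPt_sub, h] at this
  exact_mod_cast this.symm

lemma norm_latPt_sub_eq_one {a b c d : ℤ}
    (h : (a - c) ^ 2 + (a - c) * (b - d) + (b - d) ^ 2 = 1) :
    ‖latPt a b - latPt c d‖ = 1 := by
  have h2 : ‖latPt a b - latPt c d‖ ^ 2 = 1 := by
    rw [latPt_sub, norm_latPt_sq]
    exact_mod_cast h
  exact (pow_eq_one_iff_of_nonneg (norm_nonneg _) two_ne_zero).1 h2

lemma eisenstein_units {a b : ℤ} (h : a ^ 2 + a * b + b ^ 2 = 1) :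
    (a = 1 ∧ b = 0) ∨ (a = -1 ∧ b = 0) ∨ (a = 0 ∧ b = 1) ∨ (a = 0 ∧ b = -1) ∨
      (a = 1 ∧ b = -1) ∨ (a = -1 ∧ b = 1) := by
  have ha : -1 ≤ a := by nlinarith [sq_nonneg (a + 2 * b)]
  have ha' : a ≤ 1 := by nlinarith [sq_nonneg (a + 2 * b)]
  have hb : -1 ≤ b := by nlinarith [sq_nonneg (b + 2 * a)]
  have hb' : b ≤ 1 := by nlinarith [sq_nonneg (b + 2 * a)]
  interval_cases a <;> interval_cases b <;> simp_all

/-- The vertices of `T` are `A`, `B`, `C`, in this cyclic order. -/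
def Tri.HasVertices (T : Tri) (A B C : E2) : Prop :=
  (T.i = A ∧ T.j = B ∧ T.k = C) ∨ (T.i = B ∧ T.j = C ∧ T.k = A) ∨ (T.i = C ∧ T.j = A ∧ T.k = B)

lemma Tri.HasVertices.rotate {T : Tri} {A B C : E2} (h : T.HasVertices A B C) :
    T.HasVertices B C A := by
  unfold Tri.HasVertices at *; tauto

/-- `T` is the upward triangle whose lower left corner is `(m, n)`. -/
def Tri.IsUp (T : Tri) (m n : ℤ) : Prop :=
  T.HasVertices (latPt m n) (latPt (m + 1 : ℤ) n) (latPt m (n + 1 : ℤ))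

/-- `T` is the downward triangle in the lattice cell whose lower left corner is `(m, n)`. -/
def Tri.IsDown (T : Tri) (m n : ℤ) : Prop :=
  T.HasVertices (latPt (m + 1 : ℤ) (n + 1 : ℤ)) (latPt (m + 1 : ℤ) n) (latPt m (n + 1 : ℤ))

lemma Tri.isUp_or_isDown (T : Tri) : ∃ m n : ℤ, T.IsUp m n ∨ T.IsDown m n := by
  obtain ⟨i, j, k, hi, hj, hk, dij, djk, dki⟩ := T
  obtain ⟨p, q, rfl⟩ := mem_triLat1_iff.1 hi
  obtain ⟨r, s, rfl⟩ := mem_triLat2_iff.1 hj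
  obtain ⟨t, v, rfl⟩ := mem_triLat3_iff.1 hk
  simp only [Tri.IsUp, Tri.IsDown, Tri.HasVertices]
  replace dij := int_norm_eq_one dij
  replace djk := int_norm_eq_one djk
  replace dki := int_norm_eq_one dki
  clear hi hj hk
  generalize hm : p - q = m at *
  generalize hn : p + 2 * q = n at *
  generalize hm' : r - s + 1 = m' at *
  generalize hn' : r + 2 * s = n' at *
  generalize hm'' : t - v = m'' at *
  generalize hn'' : t + 2 * v + 1 = n'' at *
  have key : (m' = m + 1 ∧ n' = n ∧ m'' = m ∧ n'' = n + 1) ∨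
      (m' = m ∧ n' = n - 1 ∧ m'' = m - 1 ∧ n'' = n) ∨
      (m' = m - 1 ∧ n' = n + 1 ∧ m'' = m ∧ n'' = n + 1) ∨
      (m' = m - 1 ∧ n' = n + 1 ∧ m'' = m - 1 ∧ n'' = n) ∨
      (m' = m ∧ n' = n - 1 ∧ m'' = m + 1 ∧ n'' = n - 1) ∨
      (m' = m + 1 ∧ n' = n ∧ m'' = m + 1 ∧ n'' = n - 1) := by
    have h1 : (m' = m + 1 ∧ n' = n) ∨ (m' = m ∧ n' = n - 1) ∨ (m' = m - 1 ∧ n' = n + 1) := by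
      have := eisenstein_units dij
      omega
    have h3 : (m'' = m ∧ n'' = n + 1) ∨ (m'' = m - 1 ∧ n'' = n) ∨
        (m'' = m + 1 ∧ n'' = n - 1) := by
      have := eisenstein_units dki
      omega
    clear hm hn hm' hn' hm'' hn'' dij dki
    rcases h1 with ⟨rfl, rfl⟩ | ⟨rfl, rfl⟩ | ⟨rfl, rfl⟩ <;>
      rcases h3 with ⟨rfl, rfl⟩ | ⟨rfl, rfl⟩ | ⟨rfl, rfl⟩ <;> ring_nf at djk <;> simp at djk ⊢
  rcases key with ⟨h1, h2, h3, h4⟩ | ⟨h1, h2, h3, h4⟩ | ⟨h1, h2, h3, h4⟩ |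
    ⟨h1, h2, h3, h4⟩ | ⟨h1, h2, h3, h4⟩ | ⟨h1, h2, h3, h4⟩
  · exact ⟨m, n, by simp [h1, h2, h3, h4]⟩
  · exact ⟨m - 1, n - 1, by simp [h1, h2, h3, h4]⟩
  · exact ⟨m - 1, n, by simp [h1, h2, h3, h4]⟩
  · exact ⟨m - 1, n, by simp [h1, h2, h3, h4]⟩
  · exact ⟨m, n - 1, by simp [h1, h2, h3, h4]⟩
  · exact ⟨m, n - 1, by simp [h1, h2, h3, h4]⟩

lemma latPt_mem_triLat1 {m n : ℤ} (h : (m - n) % 3 = 0) : latPt m n ∈ TriLat1 :=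
  mem_triLat1_iff.2 ⟨m + (n - m) / 3, (n - m) / 3, by congr 2 <;> omega⟩

lemma latPt_mem_triLat2 {m n : ℤ} (h : (m - n) % 3 = 1) : latPt m n ∈ TriLat2 :=
  mem_triLat2_iff.2 ⟨m - 1 + (n - m + 1) / 3, (n - m + 1) / 3, by congr 2 <;> omega⟩

lemma latPt_mem_triLat3 {m n : ℤ} (h : (m - n) % 3 = 2) : latPt m n ∈ TriLat3 :=
  mem_triLat3_iff.2 ⟨m + (n - 1 - m) / 3, (n - 1 - m) / 3, by congr 2 <;> omega⟩

lemma exists_hasVertices {a b c d e f : ℤ} (h1 : (c - d - (a - b)) % 3 = 1)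
    (h2 : (e - f - (a - b)) % 3 = 2)
    (hAB : ‖latPt a b - latPt c d‖ = 1) (hBC : ‖latPt c d - latPt e f‖ = 1)
    (hCA : ‖latPt e f - latPt a b‖ = 1) :
    ∃ T : Tri, T.HasVertices (latPt a b) (latPt c d) (latPt e f) := by
  have h : (a - b) % 3 = 0 ∨ (a - b) % 3 = 1 ∨ (a - b) % 3 = 2 := by omega
  rcases h with h | h | h
  · exact ⟨⟨_, _, _, latPt_mem_triLat1 h, latPt_mem_triLat2 (m := c) (n := d) (by omega),
      latPt_mem_triLat3 (m := e) (n := f) (by omega), hAB, hBC, hCA⟩, Or.inl ⟨rfl, rfl, rfl⟩⟩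
  · exact ⟨⟨_, _, _, latPt_mem_triLat1 (m := e) (n := f) (by omega), latPt_mem_triLat2 h,
      latPt_mem_triLat3 (m := c) (n := d) (by omega), hCA, hAB, hBC⟩,
      Or.inr (Or.inr ⟨rfl, rfl, rfl⟩)⟩
  · exact ⟨⟨_, _, _, latPt_mem_triLat1 (m := c) (n := d) (by omega),
      latPt_mem_triLat2 (m := e) (n := f) (by omega), latPt_mem_triLat3 h, hBC, hCA, hAB⟩,
      Or.inr (Or.inl ⟨rfl, rfl, rfl⟩)⟩

lemma exists_isUp (m n : ℤ) : ∃ T : Tri, T.IsUp m n := by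
  refine exists_hasVertices (by omega) (by omega) ?_ ?_ ?_ <;>
    exact norm_latPt_sub_eq_one (by ring)

lemma exists_isDown (m n : ℤ) : ∃ T : Tri, T.IsDown m n := by
  refine exists_hasVertices (by omega) (by omega) ?_ ?_ ?_ <;>
    exact norm_latPt_sub_eq_one (by ring)

lemma Tri.HasVertices.set_eq {T : Tri} {A B C : E2} (h : T.HasVertices A B C) (ε : ℝ) :
    T.set ε = convexHull ℝ {ε • A, ε • B, ε • C} := by
  rcases h with ⟨h1, h2, h3⟩ | ⟨h1, h2, h3⟩ | ⟨h1, h2, h3⟩ <;>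
    simp only [Tri.set, h1, h2, h3] <;> congr 1 <;> ext x <;> simp <;> tauto

/-- The boundary of an `ε`-triangle. -/
def Tri.edges (ε : ℝ) (T : Tri) : Set E2 :=
  segment ℝ (ε • T.i) (ε • T.j) ∪ segment ℝ (ε • T.j) (ε • T.k) ∪
    segment ℝ (ε • T.k) (ε • T.i)

lemma Tri.HasVertices.segment_subset_edges {T : Tri} {A B C : E2} (h : T.HasVertices A B C)
    (ε : ℝ) : segment ℝ (ε • A) (ε • B) ⊆ T.edges ε := by
  rcases h with ⟨h1, h2, h3⟩ | ⟨h1, h2, h3⟩ | ⟨h1, h2, h3⟩ <;>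
    simp only [Tri.edges, h1, h2, h3] <;> intro x hx <;> simp [hx]

lemma Tri.HasVertices.chi_eq {T : Tri} {A B C : E2} (h : T.HasVertices A B C) (ε : ℝ)
    (u : E2 → E2) : chi ε u T = 2 / (3 * √3) *
      (cross (u (ε • A)) (u (ε • B)) + cross (u (ε • B)) (u (ε • C)) +
        cross (u (ε • C)) (u (ε • A))) := by
  rcases h with ⟨h1, h2, h3⟩ | ⟨h1, h2, h3⟩ | ⟨h1, h2, h3⟩ <;>
    simp only [chi, h1, h2, h3] <;> ring

lemma Tri.HasVertices.triEnergy_eq {T : Tri} {A B C : E2} (h : T.HasVertices A B C) (ε : ℝ)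
    (u : E2 → E2) : triEnergy ε u T = ε * ‖u (ε • A) + u (ε • B) + u (ε • C)‖ ^ 2 := by
  rcases h with ⟨h1, h2, h3⟩ | ⟨h1, h2, h3⟩ | ⟨h1, h2, h3⟩ <;>
    simp only [triEnergy, h1, h2, h3] <;> congr 3 <;> abel

/-- If the chirality of a triple of unit vectors has not the sign of the cross product of the
first two, then the sum of the triple has norm at least one. -/
lemma one_le_norm_sum_sq {x y z : E2} (hx : ‖x‖ = 1) (hy : ‖y‖ = 1) (hz : ‖z‖ = 1)
    (h : cross x y * (cross x y + cross y z + cross z x) ≤ 0) : 1 ≤ ‖x + y + z‖ ^ 2 := by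
  have sq : ∀ v : E2, ‖v‖ ^ 2 = v 0 ^ 2 + v 1 ^ 2 := fun v => by
    rw [EuclideanSpace.norm_sq_eq, Fin.sum_univ_two]; simp
  have hx' : x 0 ^ 2 + x 1 ^ 2 = 1 := by rw [← sq, hx, one_pow]
  have hy' : y 0 ^ 2 + y 1 ^ 2 = 1 := by rw [← sq, hy, one_pow]
  have hz' : z 0 ^ 2 + z 1 ^ 2 = 1 := by rw [← sq, hz, one_pow]
  rw [sq]
  simp only [PiLp.add_apply, cross] at *
  generalize x 0 = a at *
  generalize x 1 = b at *
  generalize y 0 = c at *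
  generalize y 1 = d at *
  generalize z 0 = e at *
  generalize z 1 = f at *
  set co := a * c + b * d with hco
  set si := a * d - b * c with hsi
  set p := a * e + b * f with hp
  set q := a * f - b * e with hq
  have h1 : co ^ 2 + si ^ 2 = 1 := by
    linear_combination (c ^ 2 + d ^ 2) * hx' + hy'
  have h2 : p ^ 2 + q ^ 2 = 1 := by
    linear_combination (e ^ 2 + f ^ 2) * hx' + hz'
  have h3 : c * e + d * f = co * p + si * q := by
    linear_combination (-(c * e + d * f)) * hx'
  have h4 : c * f - d * e = co * q - si * p := by
    linear_combination (-(c * f - d * e)) * hx'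
  have h5 : e * b - f * a = -q := by rw [hq]; ring
  rw [h4, h5] at h
  have hgoal : (a + c + e) ^ 2 + (b + d + f) ^ 2 = 3 + 2 * (co + p + (co * p + si * q)) := by
    rw [← h3]; linear_combination hx' + hy' + hz'
  rw [hgoal]
  have hc1 : co ≤ 1 := by nlinarith
  have hc2 : -1 ≤ co := by nlinarith
  have hp2 : -1 ≤ p := by nlinarith
  rcases hc1.eq_or_lt with hc | hc
  · have : si = 0 := by
      have : si ^ 2 = 0 := by rw [hc] at h1; linarith
      exact pow_eq_zero_iff two_ne_zero |>.1 this
    rw [hc, this]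
    linarith
  · have h6 : (1 - co) * ((1 + co) * (1 - p) - si * q) ≤ 0 := by
      linarith [show (1 - co) * ((1 + co) * (1 - p) - si * q) =
        si * (si + (co * q - si * p) + -q) by linear_combination (p - 1) * h1]
    have h7 : (1 + co) * (1 - p) - si * q ≤ 0 :=
      nonpos_of_mul_nonpos_right h6 (sub_pos.2 hc)
    linarith

lemma le_triEnergy {ε : ℝ} (hε : 0 < ε) {u : E2 → E2} {T : Tri} {A B C : E2}
    (h : T.HasVertices A B C) (hA : ‖u (ε • A)‖ = 1) (hB : ‖u (ε • B)‖ = 1)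
    (hC : ‖u (ε • C)‖ = 1) (hchi : cross (u (ε • A)) (u (ε • B)) * chi ε u T ≤ 0) :
    ε ≤ triEnergy ε u T := by
  rw [h.triEnergy_eq]
  rw [h.chi_eq, mul_left_comm] at hchi
  have := one_le_norm_sum_sq hA hB hC (by
    refine nonpos_of_mul_nonpos_right hchi ?_
    positivity)
  nlinarith

/-- Two triangles of opposite chirality with a common edge: one of them has large energy. -/
lemma exists_le_triEnergy_of_adjacent {ε : ℝ} (hε : 0 < ε) {u : E2 → E2}
    {T T' : Tri} {A B C C' : E2} (h : T.HasVertices A B C) (h' : T'.HasVertices A B C')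
    (hA : ‖u (ε • A)‖ = 1) (hB : ‖u (ε • B)‖ = 1) (hC : ‖u (ε • C)‖ = 1)
    (hC' : ‖u (ε • C')‖ = 1) (hchi : chi ε u T * chi ε u T' ≤ 0) {x : E2}
    (hx : x ∈ segment ℝ (ε • A) (ε • B)) :
    (ε ≤ triEnergy ε u T ∧ x ∈ T.edges ε) ∨ (ε ≤ triEnergy ε u T' ∧ x ∈ T'.edges ε) := by
  by_cases hs : cross (u (ε • A)) (u (ε • B)) * chi ε u T ≤ 0
  · exact Or.inl ⟨le_triEnergy hε h hA hB hC hs, h.segment_subset_edges ε hx⟩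
  · refine Or.inr ⟨le_triEnergy hε h' hA hB hC' ?_, h'.segment_subset_edges ε hx⟩
    push Not at hs
    by_contra! hs'
    have h1 := mul_pos hs hs'
    rw [mul_mul_mul_comm] at h1
    exact h1.not_ge (mul_nonpos_of_nonneg_of_nonpos (mul_self_nonneg _) hchi)

lemma convex_setOf_coords (P : ℝ → ℝ → Prop)
    (hP : ∀ a b c d s t : ℝ, P a b → P c d → 0 ≤ s → 0 ≤ t → s + t = 1 →
      P (s * a + t * c) (s * b + t * d)) (ε : ℝ) :
    Convex ℝ {x : E2 | ∃ a b : ℝ, x = ε • latPt a b ∧ P a b} := by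
  rintro _ ⟨a, b, rfl, h⟩ _ ⟨c, d, rfl, h'⟩ s t hs ht hst
  refine ⟨_, _, ?_, hP a b c d s t h h' hs ht hst⟩
  simp only [latPt]
  module

lemma latPt_injective {ε a b c d : ℝ} (hε : 0 < ε) (h : ε • latPt a b = ε • latPt c d) :
    a = c ∧ b = d := by
  have h' := smul_right_injective E2 hε.ne' h
  have h1 := congrArg (fun v : E2 => v 1) h'
  have h0 := congrArg (fun v : E2 => v 0) h'
  simp only [latPt_apply_one, latPt_apply_zero] at h0 h1
  have h3 : (√3 / 2 : ℝ) ≠ 0 := by positivity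
  have hb := mul_right_cancel₀ h3 h1
  exact ⟨by linarith, hb⟩

lemma add_add_smul_mem_convexHull {A B C : E2} {r s t : ℝ} (hr : 0 ≤ r) (hs : 0 ≤ s)
    (ht : 0 ≤ t) (h : r + s + t = 1) : r • A + s • B + t • C ∈ convexHull ℝ {A, B, C} := by
  have := (convex_convexHull ℝ {A, B, C}).sum_mem (t := Finset.univ) (w := ![r, s, t])
    (z := ![A, B, C]) ?_ ?_ ?_
  · simpa [Fin.sum_univ_three] using this
  · intro i _
    fin_cases i <;> simpa
  · simpa [Fin.sum_univ_three] using h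
  · intro i _
    apply subset_convexHull
    fin_cases i <;> simp

lemma Tri.IsUp.mem_set_iff {T : Tri} {m n : ℤ} (h : T.IsUp m n) {ε : ℝ} (hε : 0 < ε) {a b : ℝ} :
    ε • latPt a b ∈ T.set ε ↔ m ≤ a ∧ n ≤ b ∧ a + b ≤ m + n + 1 := by
  rw [h.set_eq]
  constructor
  · intro hx
    have hsub := convexHull_min (𝕜 := ℝ) (s := {ε • latPt m n, ε • latPt (m + 1 : ℤ) n,
      ε • latPt m (n + 1 : ℤ)}) ?_ (convex_setOf_coords
        (fun a b => m ≤ a ∧ n ≤ b ∧ a + b ≤ m + n + 1) ?_ ε)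
    · obtain ⟨a', b', heq, hab⟩ := hsub hx
      obtain ⟨rfl, rfl⟩ := latPt_injective hε heq
      exact hab
    · rintro x (rfl | rfl | rfl) <;> refine ⟨_, _, rfl, ?_⟩ <;> push_cast <;>
        refine ⟨?_, ?_, ?_⟩ <;> linarith
    · rintro a b c d s t ⟨h1, h2, h3⟩ ⟨h4, h5, h6⟩ hs ht hst
      obtain rfl : t = 1 - s := by linarith
      refine ⟨?_, ?_, ?_⟩ <;> nlinarith
  · rintro ⟨h1, h2, h3⟩
    have : ε • latPt a b = (1 - (a - m) - (b - n)) • (ε • latPt m n) +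
      (a - m) • (ε • latPt (m + 1 : ℤ) n) + (b - n) • (ε • latPt m (n + 1 : ℤ)) := by
      simp only [latPt]; push_cast; module
    rw [this]
    exact add_add_smul_mem_convexHull (by linarith) (by linarith) (by linarith) (by ring)

lemma Tri.IsDown.mem_set_iff {T : Tri} {m n : ℤ} (h : T.IsDown m n) {ε : ℝ} (hε : 0 < ε)
    {a b : ℝ} :
    ε • latPt a b ∈ T.set ε ↔ a ≤ m + 1 ∧ b ≤ n + 1 ∧ m + n + 1 ≤ a + b := by
  rw [h.set_eq]
  constructor
  · intro hx
    have hsub := convexHull_min (𝕜 := ℝ) (s := {ε • latPt (m + 1 : ℤ) (n + 1 : ℤ),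
      ε • latPt (m + 1 : ℤ) n, ε • latPt m (n + 1 : ℤ)}) ?_ (convex_setOf_coords
        (fun a b => a ≤ m + 1 ∧ b ≤ n + 1 ∧ m + n + 1 ≤ a + b) ?_ ε)
    · obtain ⟨a', b', heq, hab⟩ := hsub hx
      obtain ⟨rfl, rfl⟩ := latPt_injective hε heq
      exact hab
    · rintro x (rfl | rfl | rfl) <;> refine ⟨_, _, rfl, ?_⟩ <;> push_cast <;>
        refine ⟨?_, ?_, ?_⟩ <;> linarith
    · rintro a b c d s t ⟨h1, h2, h3⟩ ⟨h4, h5, h6⟩ hs ht hst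
      obtain rfl : t = 1 - s := by linarith
      refine ⟨?_, ?_, ?_⟩ <;> nlinarith
  · rintro ⟨h1, h2, h3⟩
    have : ε • latPt a b =
      (1 - (m + 1 - a) - (n + 1 - b)) • (ε • latPt (m + 1 : ℤ) (n + 1 : ℤ)) +
      (n + 1 - b) • (ε • latPt (m + 1 : ℤ) n) + (m + 1 - a) • (ε • latPt m (n + 1 : ℤ)) := by
      simp only [latPt]; push_cast; module
    rw [this]
    exact add_add_smul_mem_convexHull (by linarith) (by linarith) (by linarith) (by ring)

/-- The `ε`-triangles cover the plane. -/
lemma exists_mem_triSet {ε : ℝ} (hε : 0 < ε) (x : E2) : ∃ T : Tri, x ∈ T.set ε := by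
  obtain ⟨a, b, rfl⟩ := exists_eq_smul_latPt hε x
  have h1 := Int.floor_le a
  have h2 := Int.floor_le b
  have h3 := (Int.lt_floor_add_one a).le
  have h4 := (Int.lt_floor_add_one b).le
  rcases le_total (a + b) (⌊a⌋ + ⌊b⌋ + 1) with h | h
  · obtain ⟨T, hT⟩ := exists_isUp ⌊a⌋ ⌊b⌋
    exact ⟨T, (hT.mem_set_iff hε).2 ⟨h1, h2, h⟩⟩
  · obtain ⟨T, hT⟩ := exists_isDown ⌊a⌋ ⌊b⌋
    exact ⟨T, (hT.mem_set_iff hε).2 ⟨h3, h4, h⟩⟩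

lemma exists_le_triEnergy_of_isUp_of_isDown {ε : ℝ} (hε : 0 < ε) {u : E2 → E2}
    (hu : ∀ m n : ℤ, ‖u (ε • latPt m n)‖ = 1) {T T' : Tri} {m n m' n' : ℤ}
    (hT : T.IsUp m n) (hT' : T'.IsDown m' n') (hchi : chi ε u T * chi ε u T' ≤ 0) {x : E2}
    (hx : x ∈ T.set ε) (hx' : x ∈ T'.set ε) (hv : ∀ p q : ℤ, x ≠ ε • latPt p q) :
    (ε ≤ triEnergy ε u T ∧ x ∈ T.edges ε) ∨ (ε ≤ triEnergy ε u T' ∧ x ∈ T'.edges ε) := by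
  obtain ⟨a, b, rfl⟩ := exists_eq_smul_latPt hε x
  obtain ⟨h1, h2, h3⟩ := (hT.mem_set_iff hε).1 hx
  obtain ⟨h4, h5, h6⟩ := (hT'.mem_set_iff hε).1 hx'
  replace hv : ∀ p q : ℤ, a = p → b = q → False := fun p q hp hq => hv p q (by rw [hp, hq])
  have i1 : m ≤ m' + 1 := by exact_mod_cast h1.trans h4
  have i2 : n ≤ n' + 1 := by exact_mod_cast h2.trans h5
  have i3 : m' + n' ≤ m + n := by
    have := h6.trans h3
    norm_cast at this
    linarith
  have i4 : (m' = m ∧ n' = n) ∨ (m' = m - 1 ∧ n' = n) ∨ (m' = m ∧ n' = n - 1) ∨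
      (m' = m - 1 ∧ n' = n + 1) ∨ (m' = m + 1 ∧ n' = n - 1) ∨ (m' = m - 1 ∧ n' = n - 1) := by
    omega
  clear hx hx' i1 i2 i3
  rcases i4 with ⟨rfl, rfl⟩ | ⟨rfl, rfl⟩ | ⟨rfl, rfl⟩ | ⟨rfl, rfl⟩ | ⟨rfl, rfl⟩ | ⟨rfl, rfl⟩ <;>
    push_cast at h4 h5 h6
  · refine exists_le_triEnergy_of_adjacent hε hT.rotate hT'.rotate (hu _ _) (hu _ _) (hu _ _)
      (hu _ _) hchi ⟨a - m', b - n', by linarith, by linarith, by linarith, ?_⟩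
    obtain rfl : a = m' + n' + 1 - b := by linarith
    simp only [latPt]; push_cast; module
  · rw [Tri.IsDown, sub_add_cancel] at hT'
    obtain rfl : a = m := by linarith
    refine exists_le_triEnergy_of_adjacent hε hT.rotate.rotate hT' (hu _ _) (hu _ _)
      (hu _ _) (hu _ _) hchi ⟨b - n', n' + 1 - b, by linarith, by linarith, by linarith, ?_⟩
    simp only [latPt]; push_cast; module
  · rw [Tri.IsDown, sub_add_cancel] at hT'
    obtain rfl : b = n := by linarith
    refine exists_le_triEnergy_of_adjacent hε hT hT'.rotate.rotate (hu _ _) (hu _ _)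
      (hu _ _) (hu _ _) hchi ⟨m' + 1 - a, a - m', by linarith, by linarith, by linarith, ?_⟩
    simp only [latPt]; push_cast; module
  · exact (hv m (n + 1) (by linarith) (by push_cast; linarith)).elim
  · exact (hv (m + 1) n (by push_cast; linarith) (by linarith)).elim
  · exact (hv m n (by linarith) (by linarith)).elim

lemma Tri.IsUp.eq_of_mem {ε : ℝ} (hε : 0 < ε) {T T' : Tri} {m n m' n' : ℤ}
    (hT : T.IsUp m n) (hT' : T'.IsUp m' n') {x : E2} (hx : x ∈ T.set ε) (hx' : x ∈ T'.set ε)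
    (hv : ∀ p q : ℤ, x ≠ ε • latPt p q) : m = m' ∧ n = n' := by
  obtain ⟨a, b, rfl⟩ := exists_eq_smul_latPt hε x
  obtain ⟨h1, h2, h3⟩ := (hT.mem_set_iff hε).1 hx
  obtain ⟨h4, h5, h6⟩ := (hT'.mem_set_iff hε).1 hx'
  replace hv : ∀ p q : ℤ, a = p → b = q → False := fun p q hp hq => hv p q (by rw [hp, hq])
  constructor
  · rcases lt_trichotomy m m' with h | h | h
    · have : (m : ℝ) + 1 ≤ m' := by exact_mod_cast h
      exact (hv (m + 1) n (by push_cast; linarith) (by linarith)).elim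
    · exact h
    · have : (m' : ℝ) + 1 ≤ m := by exact_mod_cast h
      exact (hv (m' + 1) n' (by push_cast; linarith) (by linarith)).elim
  · rcases lt_trichotomy n n' with h | h | h
    · have : (n : ℝ) + 1 ≤ n' := by exact_mod_cast h
      exact (hv m (n + 1) (by linarith) (by push_cast; linarith)).elim
    · exact h
    · have : (n' : ℝ) + 1 ≤ n := by exact_mod_cast h
      exact (hv m' (n' + 1) (by linarith) (by push_cast; linarith)).elim

lemma Tri.IsDown.eq_of_mem {ε : ℝ} (hε : 0 < ε) {T T' : Tri} {m n m' n' : ℤ}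
    (hT : T.IsDown m n) (hT' : T'.IsDown m' n') {x : E2} (hx : x ∈ T.set ε)
    (hx' : x ∈ T'.set ε) (hv : ∀ p q : ℤ, x ≠ ε • latPt p q) : m = m' ∧ n = n' := by
  obtain ⟨a, b, rfl⟩ := exists_eq_smul_latPt hε x
  obtain ⟨h1, h2, h3⟩ := (hT.mem_set_iff hε).1 hx
  obtain ⟨h4, h5, h6⟩ := (hT'.mem_set_iff hε).1 hx'
  replace hv : ∀ p q : ℤ, a = p → b = q → False := fun p q hp hq => hv p q (by rw [hp, hq])
  constructor
  · rcases lt_trichotomy m m' with h | h | h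
    · have : (m : ℝ) + 1 ≤ m' := by exact_mod_cast h
      exact (hv (m + 1) (n' + 1) (by push_cast; linarith) (by push_cast; linarith)).elim
    · exact h
    · have : (m' : ℝ) + 1 ≤ m := by exact_mod_cast h
      exact (hv (m' + 1) (n + 1) (by push_cast; linarith) (by push_cast; linarith)).elim
  · rcases lt_trichotomy n n' with h | h | h
    · have : (n : ℝ) + 1 ≤ n' := by exact_mod_cast h
      exact (hv (m' + 1) (n + 1) (by push_cast; linarith) (by push_cast; linarith)).elim
    · exact h
    · have : (n' : ℝ) + 1 ≤ n := by exact_mod_cast h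
      exact (hv (m + 1) (n' + 1) (by push_cast; linarith) (by push_cast; linarith)).elim

/-- A point that is not a vertex and belongs to triangles of positive and of nonpositive chirality
lies on an edge of a triangle of large energy. -/
lemma exists_le_triEnergy_of_mem_inter {ε : ℝ} (hε : 0 < ε) {u : E2 → E2}
    (hu : ∀ m n : ℤ, ‖u (ε • latPt m n)‖ = 1) {T T' : Tri} (hT : 0 < chi ε u T)
    (hT' : chi ε u T' ≤ 0) {x : E2} (hx : x ∈ T.set ε) (hx' : x ∈ T'.set ε)
    (hv : ∀ p q : ℤ, x ≠ ε • latPt p q) :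
    ∃ S : Tri, x ∈ S.set ε ∧ ε ≤ triEnergy ε u S ∧ x ∈ S.edges ε := by
  have hchi : chi ε u T * chi ε u T' ≤ 0 := mul_nonpos_of_nonneg_of_nonpos hT.le hT'
  have hne : chi ε u T ≠ chi ε u T' := by linarith
  obtain ⟨m, n, h⟩ := T.isUp_or_isDown
  obtain ⟨m', n', h'⟩ := T'.isUp_or_isDown
  rcases h with h | h <;> rcases h' with h' | h'
  · obtain ⟨rfl, rfl⟩ := h.eq_of_mem hε h' hx hx' hv
    exact (hne ((h.chi_eq ε u).trans (h'.chi_eq ε u).symm)).elim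
  · rcases exists_le_triEnergy_of_isUp_of_isDown hε hu h h' hchi hx hx' hv with hS | hS
    exacts [⟨T, hx, hS⟩, ⟨T', hx', hS⟩]
  · rw [mul_comm] at hchi
    rcases exists_le_triEnergy_of_isUp_of_isDown hε hu h' h hchi hx' hx hv with hS | hS
    exacts [⟨T', hx', hS⟩, ⟨T, hx, hS⟩]
  · obtain ⟨rfl, rfl⟩ := h.eq_of_mem hε h' hx hx' hv
    exact (hne ((h.chi_eq ε u).trans (h'.chi_eq ε u).symm)).elim

lemma finite_latPt_norm_le (R : ℝ) :
    {x : E2 | (∃ m n : ℤ, x = latPt m n) ∧ ‖x‖ ≤ R}.Finite := by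
  have hfin := ((Set.finite_Icc (-⌈2 * R⌉) ⌈2 * R⌉).prod
    (Set.finite_Icc (-⌈2 * R⌉) ⌈2 * R⌉)).image (fun p : ℤ × ℤ => latPt p.1 p.2)
  refine hfin.subset ?_
  rintro _ ⟨⟨m, n, rfl⟩, hR⟩
  have h0 := norm_nonneg (latPt m n)
  have h1 := norm_latPt_sq m n
  have h2 : ‖latPt m n‖ ^ 2 ≤ R ^ 2 := pow_le_pow_left₀ h0 hR 2
  have hR0 : 0 ≤ 2 * R := by linarith
  have hm : |(m : ℝ)| ≤ 2 * R :=
    abs_le_of_sq_le_sq (by nlinarith [sq_nonneg ((m : ℝ) + 2 * n)]) hR0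
  have hn : |(n : ℝ)| ≤ 2 * R :=
    abs_le_of_sq_le_sq (by nlinarith [sq_nonneg ((n : ℝ) + 2 * m)]) hR0
  have hc := Int.le_ceil (2 * R)
  rw [abs_le] at hm hn
  refine ⟨(m, n), ⟨⟨?_, ?_⟩, ?_, ?_⟩, rfl⟩ <;>
  · have : ∀ p q : ℤ, (p : ℝ) ≤ q → p ≤ q := fun p q h => by exact_mod_cast h
    apply this
    push_cast
    linarith

lemma finite_tri_norm_le (R : ℝ) : {T : Tri | ‖T.i‖ ≤ R}.Finite := by
  set S := {x : E2 | (∃ m n : ℤ, x = latPt m n) ∧ ‖x‖ ≤ R + 1}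
  have hS : S.Finite := finite_latPt_norm_le _
  have hinj : Function.Injective (fun T : Tri => (T.i, T.j, T.k)) := by
    rintro ⟨⟩ ⟨⟩ h
    simpa using h
  refine ((hS.prod (hS.prod hS)).preimage hinj.injOn).subset fun T hT => ?_
  have hi : ‖T.i‖ ≤ R := hT
  obtain ⟨_, _, hi'⟩ := mem_triLat1_iff.1 T.hi
  obtain ⟨_, _, hj'⟩ := mem_triLat2_iff.1 T.hj
  obtain ⟨_, _, hk'⟩ := mem_triLat3_iff.1 T.hk
  refine ⟨⟨⟨_, _, hi'⟩, hi.trans (by linarith)⟩, ⟨⟨_, _, hj'⟩, ?_⟩, ⟨_, _, hk'⟩, ?_⟩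
  · change ‖T.j‖ ≤ R + 1
    linarith [norm_sub_norm_le T.j T.i, norm_sub_rev T.j T.i, T.dij]
  · change ‖T.k‖ ≤ R + 1
    linarith [norm_sub_norm_le T.k T.i, T.dki]

lemma Tri.smul_i_mem_set (ε : ℝ) (T : Tri) : ε • T.i ∈ T.set ε :=
  subset_convexHull _ _ (by simp)

lemma Tri.dist_le {ε : ℝ} (hε : 0 < ε) (T : Tri) {x y : E2} (hx : x ∈ T.set ε)
    (hy : y ∈ T.set ε) : dist x y ≤ ε := by
  have hd : ∀ v w : E2, ‖v - w‖ = 1 → dist (ε • v) (ε • w) = ε := fun v w h => by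
    rw [dist_eq_norm, ← smul_sub, norm_smul, h, mul_one, Real.norm_of_nonneg hε.le]
  have h1 := hd _ _ T.dij
  have h2 := hd _ _ T.djk
  have h3 := hd _ _ T.dki
  have h1' := (dist_comm _ _).trans h1
  have h2' := (dist_comm _ _).trans h2
  have h3' := (dist_comm _ _).trans h3
  obtain ⟨v, hv, w, hw, h⟩ := convexHull_exists_dist_ge2 hx hy
  refine h.trans ?_
  rcases hv with rfl | rfl | rfl <;> rcases hw with rfl | rfl | rfl <;>
    simp only [h1, h2, h3, h1', h2', h3', dist_self, hε.le, le_refl]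

lemma finite_tri_inter_nonempty {ε : ℝ} (hε : 0 < ε) {A : Set E2}
    (hA : Bornology.IsBounded A) : {T : Tri | (T.set ε ∩ A).Nonempty}.Finite := by
  obtain ⟨R, hR⟩ := hA.subset_closedBall 0
  refine (finite_tri_norm_le ((R + ε) / ε)).subset ?_
  rintro T ⟨x, hx, hxA⟩
  have h1 := mem_closedBall_zero_iff.1 (hR hxA)
  have h2 := T.dist_le hε (T.smul_i_mem_set ε) hx
  rw [dist_eq_norm] at h2
  have h3 := norm_sub_norm_le (ε • T.i) x
  rw [norm_smul, Real.norm_of_nonneg hε.le] at h3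
  change ‖T.i‖ ≤ _
  rw [le_div_iff₀ hε]
  linarith

lemma Tri.isClosed_set (ε : ℝ) (T : Tri) : IsClosed (T.set ε) :=
  (Set.Finite.isCompact_convexHull (𝕜 := ℝ) (by simp)).isClosed

lemma locallyFinite_triSet {ε : ℝ} (hε : 0 < ε) : LocallyFinite (fun T : Tri => T.set ε) :=
  fun x => ⟨Metric.ball x 1, Metric.ball_mem_nhds x one_pos,
    finite_tri_inter_nonempty hε Metric.isBounded_ball⟩

lemma isClosed_biUnion_triSet {ε : ℝ} (hε : 0 < ε) (S : Set Tri) :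
    IsClosed (⋃ T ∈ S, T.set ε) := by
  rw [Set.biUnion_eq_iUnion]
  exact ((locallyFinite_triSet hε).comp_injective Subtype.val_injective).isClosed_iUnion
    fun T => T.1.isClosed_set ε

lemma exists_mem_of_mem_frontier {ε : ℝ} (hε : 0 < ε) {S : Set Tri} {x : E2}
    (hx : x ∈ frontier (⋃ T ∈ S, T.set ε)) :
    (∃ T ∈ S, x ∈ T.set ε) ∧ ∃ T ∉ S, x ∈ T.set ε := by
  have hsub : (⋃ T ∈ S, T.set ε)ᶜ ⊆ ⋃ T ∈ Sᶜ, T.set ε := by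
    intro y hy
    obtain ⟨T, hT⟩ := exists_mem_triSet hε y
    exact Set.mem_biUnion (fun hS => hy (Set.mem_biUnion hS hT)) hT
  rw [frontier_eq_closure_inter_closure] at hx
  have h1 := hx.1
  have h2 := closure_minimal hsub (isClosed_biUnion_triSet hε _) hx.2
  rw [(isClosed_biUnion_triSet hε S).closure_eq] at h1
  simpa using And.intro h1 h2

lemma hausdorffMeasure_edges_le {ε : ℝ} (hε : 0 < ε) (T : Tri) :
    μH[1] (T.edges ε) ≤ ENNReal.ofReal (3 * ε) := by
  have hd : ∀ v w : E2, ‖v - w‖ = 1 → μH[1] (segment ℝ (ε • v) (ε • w)) = ENNReal.ofReal ε :=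
    fun v w h => by
      rw [hausdorffMeasure_segment, edist_dist, dist_eq_norm, ← smul_sub, norm_smul, h, mul_one,
        Real.norm_of_nonneg hε.le]
  calc μH[1] (T.edges ε) ≤ ENNReal.ofReal ε + ENNReal.ofReal ε + ENNReal.ofReal ε := by
        refine (measure_union_le _ _).trans (add_le_add ((measure_union_le _ _).trans ?_) ?_)
        · rw [hd _ _ T.dij, hd _ _ T.djk]
        · rw [hd _ _ T.dki]
    _ = ENNReal.ofReal (3 * ε) := by
        rw [← ENNReal.ofReal_add hε.le hε.le, ← ENNReal.ofReal_add (by linarith) hε.le]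
        ring_nf

lemma triEnergy_nonneg {ε : ℝ} (hε : 0 < ε) (u : E2 → E2) (T : Tri) : 0 ≤ triEnergy ε u T := by
  unfold triEnergy; positivity

/-- If `Ω' ⊆ Ω` is such that the closed ball of radius `√3·ε` around every point of `Ω'`
is contained in `Ω`, and `E` is the union of all `ε`-triangles of positive chirality, then
`ℋ¹(∂E ∩ Ω') ≤ 5·F_ε(u, Ω)`. -/
theorem stmt_18 (Ω Ω' : Set E2) (hΩo : IsOpen Ω) (hΩb : Bornology.IsBounded Ω)
    (ε : ℝ) (hε : 0 < ε) (hΩ'Ω : Ω' ⊆ Ω)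
    (hΩ' : ∀ x ∈ Ω', Metric.closedBall x (Real.sqrt 3 * ε) ⊆ Ω)
    (u : E2 → E2) (hu : ∀ x ∈ TriLat, ‖u (ε • x)‖ = 1) :
    μH[1] (frontier (⋃ T ∈ {T : Tri | 0 < chi ε u T}, Tri.set ε T) ∩ Ω') ≤
      ENNReal.ofReal (5 * F ε u Ω) := by
  have hu' : ∀ m n : ℤ, ‖u (ε • latPt m n)‖ = 1 := fun m n => hu _ (latPt_mem_triLat m n)
  have hfin : Finite {T : Tri // T.set ε ⊆ Ω} :=
    ((finite_tri_inter_nonempty hε hΩb).subset fun T (hT : T.set ε ⊆ Ω) =>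
      ⟨_, T.smul_i_mem_set ε, hT (T.smul_i_mem_set ε)⟩).to_subtype
  set V : Set E2 := Set.range fun p : ℤ × ℤ => ε • latPt p.1 p.2
  set B : {T : Tri // T.set ε ⊆ Ω} → Set E2 :=
    fun T => {x | ε ≤ triEnergy ε u T ∧ x ∈ T.1.edges ε}
  have hcover : frontier (⋃ T ∈ {T : Tri | 0 < chi ε u T}, Tri.set ε T) ∩ Ω' ⊆ V ∪ ⋃ T, B T := by
    rintro x ⟨hx, hxΩ⟩
    by_cases hV : x ∈ V
    · exact Or.inl hV
    obtain ⟨⟨T, hT, hxT⟩, T', hT', hxT'⟩ := exists_mem_of_mem_frontier hε hx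
    obtain ⟨S, hxS, hS⟩ := exists_le_triEnergy_of_mem_inter hε hu' hT (not_lt.1 hT') hxT hxT'
      fun p q h => hV ⟨(p, q), h.symm⟩
    refine Or.inr (Set.mem_iUnion.2 ⟨⟨S, fun y hy => hΩ' x hxΩ ?_⟩, hS⟩)
    have h3 : 1 ≤ √3 := Real.one_le_sqrt.2 (by norm_num)
    exact (S.dist_le hε hy hxS).trans (le_mul_of_one_le_left hε.le h3)
  have hB : ∀ T, μH[1] (B T) ≤ ENNReal.ofReal (5 * triEnergy ε u T) := by
    intro T
    by_cases h : ε ≤ triEnergy ε u T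
    · refine (measure_mono fun x hx => hx.2).trans ((hausdorffMeasure_edges_le hε T.1).trans ?_)
      exact ENNReal.ofReal_le_ofReal (by linarith)
    · simp [B, h]
  have hVnull : μH[1] V = 0 := by
    have := Measure.nullSingletonClass_hausdorff E2 (d := 1) one_pos
    exact (Set.countable_range _).measure_zero _
  calc _ ≤ μH[1] (V ∪ ⋃ T, B T) := measure_mono hcover
    _ ≤ μH[1] V + ∑' T, μH[1] (B T) :=
        (measure_union_le _ _).trans (by gcongr; exact measure_iUnion_le _)
    _ ≤ ∑' T : {T : Tri // T.set ε ⊆ Ω}, ENNReal.ofReal (5 * triEnergy ε u T) := by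
        rw [hVnull, zero_add]
        exact ENNReal.tsum_le_tsum hB
    _ = ENNReal.ofReal (5 * F ε u Ω) := by
        rw [F, ← tsum_mul_left, ENNReal.ofReal_tsum_of_nonneg _ Summable.of_finite]
        exact fun T => mul_nonneg (by norm_num) (triEnergy_nonneg hε u T)
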